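/- (Evaluations jointly strictly create limits.) Let H : Rᵒᵖ × S ⥤ Type be a profunctor, C a category and σ : C ⥤ S a functor. Suppose that for each object c of C we are given an object r_c of R and a heteromorphism h_c ∈ H(r_c, σ c) which is a limit of σ c. Then there exists exactly one pair (ρ, λ) consisting of a functor ρ : C ⥤ R and a natural family λ of heteromorphisms λ_c ∈ H(ρ c, σ c) such that ρ c = r_c and λ_c = h_c for every object c of C; moreover, this λ is a limit of σ in the power profunctor H^C. -/

import Mathlib

open CategoryTheory Opposite

universe w

/-- Pullback of a heteromorphism `h ∈ H(r,s)` along an arrow `a : r' ⟶ r`. -/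
def pullb {R S : Type*} [Category R] [Category S] (H : Rᵒᵖ × S ⥤ Type w)
    {r r' : R} {s : S} (a : r' ⟶ r) (h : H.obj (op r, s)) : H.obj (op r', s) :=
  H.map ((a.op, 𝟙 s) : ((op r, s) : Rᵒᵖ × S) ⟶ (op r', s)) h

/-- Pushforward of a heteromorphism `h ∈ H(r,s)` along an arrow `b : s ⟶ s'`. -/
def pushf {R S : Type*} [Category R] [Category S] (H : Rᵒᵖ × S ⥤ Type w)
    {r : R} {s s' : S} (b : s ⟶ s') (h : H.obj (op r, s)) : H.obj (op r, s') :=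
  H.map ((𝟙 (op r), b) : ((op r, s) : Rᵒᵖ × S) ⟶ (op r, s')) h

/-- A heteromorphism `h ∈ H(r,s)` is a limit of `s` if pulling it back is a bijection
`Hom(r',r) ≃ H(r',s)` for every `r'`. -/
def IsLimitHet {R S : Type*} [Category R] [Category S] (H : Rᵒᵖ × S ⥤ Type w)
    {r : R} {s : S} (h : H.obj (op r, s)) : Prop :=
  ∀ r' : R, Function.Bijective fun a : r' ⟶ r => pullb H a h

/-- A family of heteromorphisms `η_c ∈ H(ρ c, σ c)` is natural if
`(σ a)_*(η_c) = (ρ a)^*(η_{c'})` for every arrow `a : c ⟶ c'`. These families are the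
elements `H^C(ρ,σ)` of the power profunctor `H^C`. -/
def NatFam {R S C : Type*} [Category R] [Category S] [Category C]
    (H : Rᵒᵖ × S ⥤ Type w) (ρ : C ⥤ R) (σ : C ⥤ S)
    (η : ∀ c : C, H.obj (op (ρ.obj c), σ.obj c)) : Prop :=
  ∀ {c c' : C} (a : c ⟶ c'), pushf H (σ.map a) (η c) = pullb H (ρ.map a) (η c')

/-- A natural family `λ ∈ H^C(ρ,σ)` is a limit of `σ` in the power profunctor `H^C` if for
every `ρ' : C ⥤ R` the map `α ↦ ((α_c)^*(λ_c))_c` is a bijection from `ρ' ⟶ ρ` onto the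
set of natural families in `H(ρ' c, σ c)`. -/
def IsLimitPow {R S C : Type*} [Category R] [Category S] [Category C]
    (H : Rᵒᵖ × S ⥤ Type w) (ρ : C ⥤ R) (σ : C ⥤ S)
    (lam : ∀ c : C, H.obj (op (ρ.obj c), σ.obj c)) : Prop :=
  ∀ ρ' : C ⥤ R,
    Function.Injective (fun α : ρ' ⟶ ρ => fun c : C => pullb H (α.app c) (lam c)) ∧
    Set.range (fun α : ρ' ⟶ ρ => fun c : C => pullb H (α.app c) (lam c)) =
      {η : ∀ c : C, H.obj (op (ρ'.obj c), σ.obj c) | NatFam H ρ' σ η}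

theorem pullb_id {R S : Type*} [Category R] [Category S] (H : Rᵒᵖ × S ⥤ Type w)
    {r : R} {s : S} (h : H.obj (op r, s)) : pullb H (𝟙 r) h = h := by
  have := H.map_id (op r, s)
  exact congrArg (fun f => f h) this

theorem pushf_id {R S : Type*} [Category R] [Category S] (H : Rᵒᵖ × S ⥤ Type w)
    {r : R} {s : S} (h : H.obj (op r, s)) : pushf H (𝟙 s) h = h := pullb_id H h

theorem pullb_comp {R S : Type*} [Category R] [Category S] (H : Rᵒᵖ × S ⥤ Type w)
    {r r' r'' : R} {s : S} (a : r'' ⟶ r') (b : r' ⟶ r) (h : H.obj (op r, s)) :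
    pullb H (a ≫ b) h = pullb H a (pullb H b h) := by
  simp only [pullb, ← comp_apply, ← H.map_comp, prod_comp, op_comp, Category.comp_id]

theorem pushf_comp {R S : Type*} [Category R] [Category S] (H : Rᵒᵖ × S ⥤ Type w)
    {r : R} {s s' s'' : S} (a : s ⟶ s') (b : s' ⟶ s'') (h : H.obj (op r, s)) :
    pushf H (a ≫ b) h = pushf H b (pushf H a h) := by
  simp only [pushf, ← comp_apply, ← H.map_comp, prod_comp, Category.comp_id]

theorem pushf_pullb {R S : Type*} [Category R] [Category S] (H : Rᵒᵖ × S ⥤ Type w)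
    {r r' : R} {s s' : S} (a : r' ⟶ r) (b : s ⟶ s') (h : H.obj (op r, s)) :
    pushf H b (pullb H a h) = pullb H a (pushf H b h) := by
  simp only [pushf, pullb, ← comp_apply, ← H.map_comp, prod_comp, Category.comp_id,
    Category.id_comp]

/-- The functor determined by a family of pointwise limits. -/
noncomputable def limitFunctor {R S C : Type*} [Category R] [Category S] [Category C]
    (H : Rᵒᵖ × S ⥤ Type w) (σ : C ⥤ S) (r : C → R)
    (h : ∀ c : C, H.obj (op (r c), σ.obj c))
    (hlim : ∀ c : C, IsLimitHet H (h c)) : C ⥤ R where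
  obj := r
  map {c c'} a := ((hlim c' (r c)).2 (pushf H (σ.map a) (h c))).choose
  map_id c := by
    apply (hlim c (r c)).1
    refine ((hlim c (r c)).2 (pushf H (σ.map (𝟙 c)) (h c))).choose_spec.trans ?_
    simp only [σ.map_id, pushf_id, pullb_id]
  map_comp {c c' c''} a b := by
    apply (hlim c'' (r c)).1
    refine ((hlim c'' (r c)).2 (pushf H (σ.map (a ≫ b)) (h c))).choose_spec.trans ?_
    have ha := ((hlim c' (r c)).2 (pushf H (σ.map a) (h c))).choose_spec
    have hb := ((hlim c'' (r c')).2 (pushf H (σ.map b) (h c'))).choose_spec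
    dsimp only at ha hb ⊢
    rw [pullb_comp, hb, ← pushf_pullb, ha, σ.map_comp, pushf_comp]

theorem natFam_limitFunctor {R S C : Type*} [Category R] [Category S] [Category C]
    (H : Rᵒᵖ × S ⥤ Type w) (σ : C ⥤ S) (r : C → R)
    (h : ∀ c : C, H.obj (op (r c), σ.obj c))
    (hlim : ∀ c : C, IsLimitHet H (h c)) :
    NatFam H (limitFunctor H σ r h hlim) σ h := fun {c c'} a =>
  ((hlim c' (r c)).2 (pushf H (σ.map a) (h c))).choose_spec.symm

/-- Two natural families of limits with the same objects and heteromorphisms are equal. -/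
theorem NatFam.sigma_ext {R S C : Type*} [Category R] [Category S] [Category C]
    {H : Rᵒᵖ × S ⥤ Type w} {σ : C ⥤ S}
    {p q : Σ ρ : C ⥤ R, ∀ c : C, H.obj (op (ρ.obj c), σ.obj c)}
    (hp : NatFam H p.1 σ p.2) (hq : NatFam H q.1 σ q.2)
    (hlim : ∀ c : C, IsLimitHet H (q.2 c))
    (hobj : ∀ c : C, p.1.obj c = q.1.obj c) (hhet : ∀ c : C, HEq (p.2 c) (q.2 c)) : p = q := by
  obtain ⟨⟨obj, map, map_id, map_comp⟩, η⟩ := p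
  obtain ⟨⟨obj', map', map_id', map_comp'⟩, η'⟩ := q
  obtain rfl : obj = obj' := funext hobj
  obtain rfl : η = η' := funext fun c => eq_of_heq (hhet c)
  obtain rfl : @map = @map' := by
    funext c c' a
    exact (hlim c' (obj c)).1 ((hp a).symm.trans (hq a))
  rfl

/-- A natural family of limits is a limit in the power profunctor. -/
theorem NatFam.isLimitPow {R S C : Type*} [Category R] [Category S] [Category C]
    {H : Rᵒᵖ × S ⥤ Type w} {ρ : C ⥤ R} {σ : C ⥤ S}
    {η : ∀ c : C, H.obj (op (ρ.obj c), σ.obj c)}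
    (hη : NatFam H ρ σ η) (hlim : ∀ c : C, IsLimitHet H (η c)) : IsLimitPow H ρ σ η := by
  refine fun ρ' => ⟨fun α β hαβ => ?_, Set.Subset.antisymm ?_ fun θ hθ => ?_⟩
  · ext c
    exact (hlim c (ρ'.obj c)).1 (congrFun hαβ c)
  · rintro _ ⟨α, rfl⟩ c c' a
    dsimp only
    rw [pushf_pullb, hη a, ← pullb_comp, ← pullb_comp, α.naturality]
  · choose α hα using fun c => (hlim c (ρ'.obj c)).2 (θ c)
    dsimp only at hα
    refine ⟨⟨α, fun c c' a => (hlim c' (ρ'.obj c)).1 ?_⟩, funext hα⟩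
    have h_nat : pushf H (σ.map a) (θ c) = pullb H (ρ'.map a) (θ c') := hθ a
    dsimp only
    rw [pullb_comp, pullb_comp, hα, ← hη a, ← pushf_pullb, hα, h_nat]

/-- Evaluations jointly strictly create limits: given limits `h_c ∈ H(r_c, σ c)` of each
`σ c`, there is exactly one pair `(ρ, λ)` of a functor `ρ : C ⥤ R` and a natural family
`λ_c ∈ H(ρ c, σ c)` with `ρ c = r_c` and `λ_c = h_c` for all `c`; moreover any such `λ`
is a limit of `σ` in the power profunctor `H^C`. -/
theorem stmt9 {R S C : Type*} [Category R] [Category S] [Category C]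
    (H : Rᵒᵖ × S ⥤ Type w) (σ : C ⥤ S) (r : C → R)
    (h : ∀ c : C, H.obj (op (r c), σ.obj c))
    (hlim : ∀ c : C, IsLimitHet H (h c)) :
    (∃! p : Σ ρ : C ⥤ R, ∀ c : C, H.obj (op (ρ.obj c), σ.obj c),
        NatFam H p.1 σ p.2 ∧ (∀ c : C, p.1.obj c = r c) ∧ ∀ c : C, HEq (p.2 c) (h c)) ∧
    ∀ p : Σ ρ : C ⥤ R, ∀ c : C, H.obj (op (ρ.obj c), σ.obj c),
      (NatFam H p.1 σ p.2 ∧ (∀ c : C, p.1.obj c = r c) ∧ ∀ c : C, HEq (p.2 c) (h c)) →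
      IsLimitPow H p.1 σ p.2 := by
  have h_lim : ∀ p : Σ ρ : C ⥤ R, ∀ c : C, H.obj (op (ρ.obj c), σ.obj c),
      (∀ c, p.1.obj c = r c) → (∀ c, HEq (p.2 c) (h c)) → ∀ c, IsLimitHet H (p.2 c) := by
    rintro ⟨ρ, η⟩ hobj hhet c
    obtain rfl : r = ρ.obj := funext fun c => (hobj c).symm
    obtain rfl : η = h := funext fun c => eq_of_heq (hhet c)
    exact hlim c
  refine ⟨⟨⟨limitFunctor H σ r h hlim, h⟩,
    ⟨natFam_limitFunctor H σ r h hlim, fun _ => rfl, fun _ => HEq.rfl⟩, ?_⟩, ?_⟩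
  · rintro p ⟨hp, hobj, hhet⟩
    exact hp.sigma_ext (natFam_limitFunctor H σ r h hlim) hlim hobj hhet
  · rintro p ⟨hp, hobj, hhet⟩
    exact hp.isLimitPow (h_lim p hobj hhet)
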